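/- Let f be a modular form of weight 4 for the Hecke congruence subgroup Γ₀(2), and write its Fourier expansion at infinity as f(z) = Σ_{n≥0} a_n q^n with q = e^{2πiz}. If a₀ = 0 and a₁ = 0, then f is identically zero. -/

import Mathlib

open UpperHalfPlane ModularForm Filter Asymptotics Topology MatrixGroups
open scoped Manifold
open Function.Periodic (qParam)

/-- If a modular form is `O(q ^ N)` at `∞`, then its `q`-expansion has order at least `N`. -/
lemma ModularFormClass.le_order_qExpansion_of_isBigO {F : Type*} [FunLike F ℍ ℂ]
    {Γ : Subgroup (GL (Fin 2) ℝ)} {k : ℤ} [ModularFormClass F Γ k] (f : F)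
    (hΓ : (1 : ℝ) ∈ Γ.strictPeriods) {N : ℕ}
    (hf : (f : ℍ → ℂ) =O[atImInfty] fun τ : ℍ ↦ qParam 1 τ ^ N) :
    (N : ℕ∞) ≤ (qExpansion 1 f).order := by
  refine PowerSeries.le_order _ _ fun n hn ↦ ?_
  have hn : n < N := mod_cast hn
  obtain ⟨C, hC⟩ := hf.bound
  obtain ⟨A, hA⟩ := (atImInfty_mem _).mp hC
  have hbound : ∀ t : ℝ, 0 < t → A ≤ t →
      ‖(qExpansion 1 f).coeff n‖ ≤ C * Real.exp (-2 * Real.pi * t) ^ (N - n) := by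
    intro t ht hAt
    rw [ModularFormClass.qExpansion_coeff_eq_intervalIntegral f one_pos hΓ n ht]
    simp only [Complex.ofReal_one, div_one, one_mul]
    refine (intervalIntegral.norm_integral_le_of_norm_le_const
      (C := C * Real.exp (-2 * Real.pi * t) ^ (N - n)) fun u _ ↦ ?_).trans (by simp)
    have h := hA ⟨u + t * Complex.I, by simpa using ht⟩ (by simpa [UpperHalfPlane.im] using hAt)
    have hq : ‖qParam 1 (u + t * Complex.I)‖ = Real.exp (-2 * Real.pi * t) := by
      simp [Function.Periodic.norm_qParam]
    simp only [Set.mem_ofPred_eq, norm_pow, hq] at h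
    rw [norm_mul, norm_div, norm_one, norm_pow, hq, one_div_mul_eq_div, div_le_iff₀ (by positivity),
      mul_assoc, ← pow_add, Nat.sub_add_cancel hn.le]
    exact h
  have hlim : Tendsto (fun t : ℝ ↦ C * Real.exp (-2 * Real.pi * t) ^ (N - n)) atTop (𝓝 0) := by
    have hexp : Tendsto (fun t : ℝ ↦ Real.exp (-2 * Real.pi * t)) atTop (𝓝 0) :=
      Real.tendsto_exp_atBot.comp
        (tendsto_id.const_mul_atTop_of_neg (by linarith [Real.pi_pos]))
    simpa [zero_pow (Nat.sub_ne_zero_of_lt hn)] using (hexp.pow (N - n)).const_mul C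
  refine norm_le_zero_iff.mp (ge_of_tendsto hlim ?_)
  filter_upwards [eventually_gt_atTop 0, eventually_ge_atTop A] with t ht hAt using hbound t ht hAt

/-- Two elements of `SL(2, ℤ)` with the same first column modulo `2` lie in the same left coset
of `Γ₀(2)`. -/
lemma CongruenceSubgroup.inv_mul_mem_Gamma0_two {g h : SL(2, ℤ)}
    (h0 : (g 0 0 : ZMod 2) = h 0 0) (h1 : (g 1 0 : ZMod 2) = h 1 0) :
    g⁻¹ * h ∈ CongruenceSubgroup.Gamma0 2 := by
  rw [CongruenceSubgroup.Gamma0_mem]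
  rw [Matrix.SpecialLinearGroup.coe_mul, Matrix.SpecialLinearGroup.coe_inv, Matrix.adjugate_fin_two]
  simp [Matrix.mul_apply, Fin.sum_univ_two, h0, h1, mul_comm, CharTwo.add_self_eq_zero]

/-- The index of `Γ₀(2)` in `SL(2, ℤ)` is at most `4`. -/
lemma CongruenceSubgroup.card_quotient_Gamma0_two_le :
    Nat.card (𝒮ℒ ⧸ (CongruenceSubgroup.Gamma0 2 : Subgroup (GL (Fin 2) ℝ)).subgroupOf 𝒮ℒ) ≤ 4 := by
  have hlift (g : 𝒮ℒ) : ∃ γ : SL(2, ℤ), Matrix.SpecialLinearGroup.mapGL ℝ γ = g.val := g.2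
  choose γ hγ using hlift
  let col (g : 𝒮ℒ) : ZMod 2 × ZMod 2 := (γ g 0 0, γ g 1 0)
  have hinj : Function.Injective fun q :
      𝒮ℒ ⧸ (CongruenceSubgroup.Gamma0 2 : Subgroup (GL (Fin 2) ℝ)).subgroupOf 𝒮ℒ ↦ col q.out := by
    intro p q hpq
    obtain ⟨h0, h1⟩ := Prod.ext_iff.mp hpq
    rw [← p.out_eq', ← q.out_eq', QuotientGroup.eq, Subgroup.mem_subgroupOf]
    refine ⟨_, CongruenceSubgroup.inv_mul_mem_Gamma0_two h0 h1, ?_⟩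
    simp [hγ]
  simpa using Nat.card_le_card_of_injective _ hinj

/-- A modular form for `Γ ≤ SL(2, ℤ)` which is `O(g)` at `∞` has a norm to level one which is
`O(g)` at `∞`. -/
lemma ModularForm.norm_isBigO {Γ : Subgroup SL(2, ℤ)} [Γ.FiniteIndex] {k : ℤ}
    (f : ModularForm Γ k) {g : ℍ → ℂ} (hf : (f : ℍ → ℂ) =O[atImInfty] g) :
    (ModularForm.norm 𝒮ℒ f : ℍ → ℂ) =O[atImInfty] g := by
  classical
  let := Fintype.ofFinite (𝒮ℒ ⧸ (Γ : Subgroup (GL (Fin 2) ℝ)).subgroupOf 𝒮ℒ)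
  let q₁ : 𝒮ℒ ⧸ (Γ : Subgroup (GL (Fin 2) ℝ)).subgroupOf 𝒮ℒ := ⟦1⟧
  rw [ModularForm.coe_norm, ← Finset.mul_prod_erase Finset.univ
    (SlashInvariantForm.quotientFunc f) (Finset.mem_univ q₁)]
  have hrest : (∏ q ∈ Finset.univ.erase q₁, SlashInvariantForm.quotientFunc f q)
      =O[atImInfty] fun _ : ℍ ↦ (1 : ℂ) := by
    rw [show (fun _ : ℍ ↦ (1 : ℂ)) = fun τ ↦ ∏ q ∈ Finset.univ.erase q₁, (1 : ℂ) by simp,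
      Finset.prod_fn]
    refine .finsetProd fun q _ ↦ ?_
    induction q using Quotient.inductionOn with
    | h r =>
      obtain ⟨γ, hγ⟩ := r.2
      have := ModularFormClass.bdd_at_infty_slash f γ⁻¹
      rw [SL_slash] at this
      rw [map_inv] at this
      rw [SlashInvariantForm.quotientFunc_mk, ← hγ]
      exact this.trans (isBigO_of_le _ (by simp))
  have hone : SlashInvariantForm.quotientFunc f q₁ = (f : ℍ → ℂ) := by simp [q₁]
  rw [hone]
  simpa only [mul_one] using! hf.mul hrest

/-- If a holomorphic function on `ℍ` is given everywhere by the (possibly junk) sum of a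
`q`-series, then the `q`-series converges everywhere or the function vanishes. -/
lemma UpperHalfPlane.hasSum_or_eq_zero_of_eq_tsum {f : ℍ → ℂ} (hf : MDiff f) {a : ℕ → ℂ}
    (ha : ∀ τ : ℍ, f τ = ∑' n, a n * qParam 1 τ ^ n) :
    (∀ τ : ℍ, HasSum (fun n ↦ a n * qParam 1 τ ^ n) (f τ)) ∨ f = 0 := by
  by_cases! hs : ∀ τ : ℍ, Summable fun n ↦ a n * qParam 1 τ ^ n
  · exact .inl fun τ ↦ ha τ ▸ (hs τ).hasSum
  obtain ⟨τ₀, hτ₀⟩ := hs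
  have hzero (τ : ℍ) (hτ : τ.im < τ₀.im) : f τ = 0 := by
    rw [ha τ]
    refine tsum_eq_zero_of_not_summable fun h ↦ hτ₀ ?_
    refine summable_powerSeries_of_norm_lt h.hasSum.tendsto_sum_nat.cauchySeq ?_
    simpa [Function.Periodic.norm_qParam] using
      mul_lt_mul_of_pos_left hτ Real.two_pi_pos
  have hpos : 0 < τ₀.im / 2 := half_pos τ₀.im_pos
  refine .inr (eq_zero_of_frequently hf (τ := ⟨(τ₀.im / 2 : ℝ) * Complex.I, by simpa using hpos⟩) ?_)
  refine (Eventually.filter_mono nhdsWithin_le_nhds ?_).frequently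
  have hopen : IsOpen {τ : ℍ | τ.im < τ₀.im} :=
    isOpen_lt UpperHalfPlane.continuous_im continuous_const
  filter_upwards [hopen.mem_nhds (by simpa using half_lt_self τ₀.im_pos)] with τ hτ using hzero τ hτ

/-- A `q`-series convergent on `ℍ` with first `N` coefficients zero is `O(q ^ N)` at `∞`. -/
lemma UpperHalfPlane.isBigO_qParam_pow_of_hasSum {f : ℍ → ℂ}
    {a : ℕ → ℂ} {N : ℕ} (ha : ∀ n < N, a n = 0)
    (hsum : ∀ τ : ℍ, HasSum (fun n ↦ a n * qParam 1 τ ^ n) (f τ)) :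
    f =O[atImInfty] fun τ : ℍ ↦ qParam 1 τ ^ N := by
  have hsum' (τ : ℍ) : HasSum (fun n ↦ a (n + N) • qParam 1 τ ^ n) (f τ / qParam 1 τ ^ N) := by
    have hq : qParam 1 τ ^ N ≠ 0 := pow_ne_zero _ (Function.Periodic.qParam_ne_zero _)
    have h := (hasSum_nat_add_iff' N).mpr (hsum τ)
    rw [Finset.sum_eq_zero fun n hn ↦ by simp [ha n (Finset.mem_range.mp hn)], sub_zero] at h
    convert! h.div_const (qParam 1 τ ^ N) using 2 with n
    rw [pow_add, smul_eq_mul]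
    field_simp
  have hb : IsBoundedAtImInfty fun τ : ℍ ↦ f τ / qParam 1 τ ^ N :=
    isBoundedAtImInfty_of_hasSum_qExpansion one_pos hsum'
  rw [← isBigO_norm_right]
  refine (IsBigO.mul hb (isBigO_refl (fun τ : ℍ ↦ qParam 1 τ ^ N) atImInfty).norm_right).congr
    (fun τ ↦ div_mul_cancel₀ _ (pow_ne_zero _ (Function.Periodic.qParam_ne_zero _))) fun τ ↦ ?_
  simp

/-- If a modular form `f` of weight 4 for `Γ₀(2)` has Fourier expansion
`f(z) = ∑_{n≥0} aₙ e^{2πinz}` at infinity with `a₀ = 0` and `a₁ = 0`,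
then `f` is identically zero. -/
theorem modularForm_eq_zero_of_first_two_coeffs_vanish
    (f : ModularForm (CongruenceSubgroup.Gamma0 2) 4) (a : ℕ → ℂ)
    (hexp : ∀ z : UpperHalfPlane,
      f z = ∑' n : ℕ, a n * Complex.exp (2 * Real.pi * Complex.I * n * (z : ℂ)))
    (ha0 : a 0 = 0) (ha1 : a 1 = 0) :
    f = 0 := by
  rw [← DFunLike.coe_injective.eq_iff, FunLike.coe_zero]
  have hexp' (τ : ℍ) : f τ = ∑' n, a n * qParam 1 τ ^ n := by
    rw [hexp τ]
    refine tsum_congr fun n ↦ ?_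
    rw [qParam, ← Complex.exp_nat_mul]
    congr 2
    push_cast
    ring
  obtain hsum | h0 := UpperHalfPlane.hasSum_or_eq_zero_of_eq_tsum f.holo' hexp'
  swap
  · exact h0
  have hf : (f : ℍ → ℂ) =O[atImInfty] fun τ : ℍ ↦ qParam 1 τ ^ 2 :=
    isBigO_qParam_pow_of_hasSum (fun n hn ↦ by interval_cases n <;> assumption) hsum
  have horder := ModularFormClass.le_order_qExpansion_of_isBigO (ModularForm.norm 𝒮ℒ f)
    one_mem_strictPeriods_SL (ModularForm.norm_isBigO f hf)
  rw [← ModularForm.norm_eq_zero_iff 𝒮ℒ f]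
  refine ModularForm.sturm_bound_levelOne (lt_of_lt_of_le ?_ horder)
  have := CongruenceSubgroup.card_quotient_Gamma0_two_le
  norm_cast
  omega
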